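/- (CALM calibration guarantee, risk-consistency form.) Let (𝒫, 𝒜) be a measurable space with probability measure μ, let k ≥ 1 and n ≥ 1, let δ, ε ∈ (0,1), and let r_full : 𝒫 → [0,1] and r_1, …, r_k : 𝒫 → [0,1] be measurable risk functions (the per-example risks of the full model and of the early-exit model at thresholds λ_1 > … > λ_k, respectively). Define the clipped excess losses L_j := max(0, r_j − r_full) : 𝒫 → [0,1]. Model the i.i.d. calibration sample of size n on the product space Ω := 𝒫^n with ℙ := μ^{⊗n}. For ω = (ω_1, …, ω_n) ∈ Ω define the empirical risks Ê_j(ω) := (1/n) ∑_{i=1}^n L_j(ω_i) and the Hoeffding p-values p_j(ω) := exp(−2n · (max(0, δ − Ê_j(ω)))²) for j = 1, …, k. Let J(ω) be the largest index j ∈ {0, 1, …, k} such that p_i(ω) ≤ ε for all i ≤ j (so J(ω) = 0 if p_1(ω) > ε). Then ℙ({ω : J(ω) = 0 or ∫ r_{J(ω)} dμ ≤ ∫ r_full dμ + δ}) ≥ 1 − ε; that is, with probability at least 1 − ε over the calibration draw, the calibrated model is risk consistent: its expected risk exceeds that of the full model by at most δ (the fallback J = 0 corresponds to threshold λ = 1,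 which reproduces the full model exactly and hence is trivially risk consistent). -/

import Mathlib

open MeasureTheory

/-- The index `J(ω) ∈ {0, 1, …, k}` selected by fixed sequence testing at level `ε`
over the Hoeffding p-values `p_j(ω) := exp (−2n (max 0 (δ − Ê_j(ω)))²)`, where
`Ê_j(ω) := (1/n) ∑_{s} L j (ω s)` is the empirical risk of the `j`-th loss on the
calibration sample `ω : Fin n → P` : it is the largest `j ≤ k` such that `p_i(ω) ≤ ε`
for all `1 ≤ i ≤ j` (and `0` if `p_1(ω) > ε`). -/
noncomputable def calmIndex {P : Type*} (k n : ℕ) (δ ε : ℝ) (L : ℕ → P → ℝ)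
    (ω : Fin n → P) : ℕ :=
  sSup {j | j ≤ k ∧ ∀ i, 1 ≤ i → i ≤ j →
    Real.exp (-(2 * (n : ℝ)) *
      (max 0 (δ - (1 / (n : ℝ)) * ∑ s, L i (ω s))) ^ 2) ≤ ε}

open ProbabilityTheory

/-- One-sided Hoeffding inequality for the lower deviations of the sum of an i.i.d. sample of a
`[0,1]`-valued function. -/
theorem measureReal_pi_sum_integral_sub_ge_le {P : Type*} [MeasurableSpace P] (μ : Measure P)
    [IsProbabilityMeasure μ] {n : ℕ} {f : P → ℝ} (hf : Measurable f)
    (hf01 : ∀ x, f x ∈ Set.Icc (0 : ℝ) 1) {t : ℝ} (ht : 0 ≤ t) :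
    (Measure.pi (fun _ : Fin n => μ)).real {ω | t ≤ ∑ s, ((∫ x, f x ∂μ) - f (ω s))}
      ≤ Real.exp (-(2 * t ^ 2) / n) := by
  have hsub : HasSubgaussianMGF (fun x => (∫ x, f x ∂μ) - f x) ((‖(1 : ℝ) - 0‖₊ / 2) ^ 2) μ :=
    (hasSubgaussianMGF_of_mem_Icc hf.aemeasurable (ae_of_all _ hf01)).neg.congr
      (ae_of_all _ fun x => by simp)
  have hindep : iIndepFun (fun (s : Fin n) (ω : Fin n → P) => (∫ x, f x ∂μ) - f (ω s))
      (Measure.pi (fun _ : Fin n => μ)) :=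
    iIndepFun_pi (μ := fun _ : Fin n => μ) (X := fun _ x => (∫ x, f x ∂μ) - f x)
      fun _ => by fun_prop
  have hsubs : ∀ s ∈ (Finset.univ : Finset (Fin n)),
      HasSubgaussianMGF (fun ω : Fin n → P => (∫ x, f x ∂μ) - f (ω s))
        ((‖(1 : ℝ) - 0‖₊ / 2) ^ 2) (Measure.pi (fun _ : Fin n => μ)) := fun s _ =>
    HasSubgaussianMGF.of_map (X := fun x => (∫ x, f x ∂μ) - f x)
      (Y := fun ω : Fin n → P => ω s) (measurable_pi_apply s).aemeasurable
      (by rwa [show (Measure.pi fun _ : Fin n => μ).map (fun ω : Fin n → P => ω s) = μ from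
        (measurePreserving_eval (fun _ : Fin n => μ) s).map_eq])
  refine (HasSubgaussianMGF.measure_sum_ge_le_of_iIndepFun hindep hsubs ht).trans_eq ?_
  congr 1
  rcases Nat.eq_zero_or_pos n with rfl | hn
  · simp
  · simp
    field_simp

/-- Validity of the Hoeffding p-value: if the mean of a `[0,1]`-valued function exceeds `δ`, its
p-value for tolerance `δ` falls below `ε` with probability at most `ε`. -/
theorem measure_pi_hoeffding_pvalue_le {P : Type*} [MeasurableSpace P] (μ : Measure P)
    [IsProbabilityMeasure μ] {n : ℕ} (hn : 1 ≤ n) {δ ε : ℝ} (hε : ε ∈ Set.Ioo (0 : ℝ) 1)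
    {f : P → ℝ} (hf : Measurable f) (hf01 : ∀ x, f x ∈ Set.Icc (0 : ℝ) 1)
    (hδ : δ < ∫ x, f x ∂μ) :
    (Measure.pi (fun _ : Fin n => μ)) {ω | Real.exp (-(2 * (n : ℝ)) *
      (max 0 (δ - (1 / (n : ℝ)) * ∑ s, f (ω s))) ^ 2) ≤ ε} ≤ ENNReal.ofReal ε := by
  have hn0 : (0 : ℝ) < n := by exact_mod_cast hn
  have hlog : Real.log ε < 0 := Real.log_neg hε.1 hε.2
  set t : ℝ := √(-Real.log ε / (2 * n))
  have harg : 0 < -Real.log ε / (2 * n) := div_pos (by linarith) (by positivity)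
  have ht : 0 < t := Real.sqrt_pos.2 harg
  have htsq : t ^ 2 = -Real.log ε / (2 * n) := Real.sq_sqrt harg.le
  have hsubset : {ω : Fin n → P | Real.exp (-(2 * (n : ℝ)) *
      (max 0 (δ - (1 / (n : ℝ)) * ∑ s, f (ω s))) ^ 2) ≤ ε} ⊆
      {ω | n * t ≤ ∑ s, ((∫ x, f x ∂μ) - f (ω s))} := by
    intro ω hω
    simp only [Set.mem_ofPred_eq] at hω ⊢
    rw [← Real.le_log_iff_exp_le hε.1] at hω
    have hsq : t ^ 2 ≤ (max 0 (δ - (1 / (n : ℝ)) * ∑ s, f (ω s))) ^ 2 := by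
      rw [htsq, div_le_iff₀ (by positivity)]
      linarith
    have hle : t ≤ δ - (1 / (n : ℝ)) * ∑ s, f (ω s) :=
      (le_max_iff.1 (le_of_sq_le_sq hsq (le_max_left _ _))).resolve_left ht.not_ge
    have hmean : n * ((1 / (n : ℝ)) * ∑ s, f (ω s)) = ∑ s, f (ω s) := by field_simp
    simp only [Finset.sum_sub_distrib, Finset.sum_const, Finset.card_univ, Fintype.card_fin,
      nsmul_eq_mul]
    nlinarith
  refine (measure_mono hsubset).trans ?_
  rw [← ofReal_measureReal]
  refine ENNReal.ofReal_le_ofReal ?_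
  refine (measureReal_pi_sum_integral_sub_ge_le μ hf hf01 (by positivity)).trans_eq ?_
  have hexp : -(2 * (n * t) ^ 2) / n = Real.log ε := by
    rw [mul_pow, htsq]
    field_simp
  rw [hexp, Real.exp_log hε.1]

/-- The selected index is at most `k`, and every p-value up to it is at most `ε`. -/
theorem calmIndex_spec {P : Type*} (k n : ℕ) (δ ε : ℝ) (L : ℕ → P → ℝ) (ω : Fin n → P) :
    calmIndex k n δ ε L ω ≤ k ∧ ∀ i, 1 ≤ i → i ≤ calmIndex k n δ ε L ω →
      Real.exp (-(2 * (n : ℝ)) *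
        (max 0 (δ - (1 / (n : ℝ)) * ∑ s, L i (ω s))) ^ 2) ≤ ε :=
  Nat.sSup_mem (s := {j | j ≤ k ∧ ∀ i, 1 ≤ i → i ≤ j → Real.exp (-(2 * (n : ℝ)) *
      (max 0 (δ - (1 / (n : ℝ)) * ∑ s, L i (ω s))) ^ 2) ≤ ε})
    ⟨0, Nat.zero_le k, fun i h1 h0 => by omega⟩ ⟨k, fun _ hj => hj.1⟩

/-- (CALM calibration guarantee, risk-consistency form.) Let `rfull` and `r 1, …, r k`
be `[0,1]`-valued measurable per-example risks of the full model and of the early-exit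
model at thresholds `λ_1 > … > λ_k`, and let `L j := max 0 (r j − rfull)` be the clipped
excess losses. Drawing an i.i.d. calibration sample of size `n` from `μ` and selecting
the index `J` by fixed sequence testing at level `ε` on the Hoeffding p-values for
tolerance `δ`, with probability at least `1 − ε` either `J = 0` (the fallback threshold
`λ = 1`, which reproduces the full model exactly) or the calibrated model is risk
consistent: `∫ r_J dμ ≤ ∫ rfull dμ + δ`. -/
theorem calm_calibration_risk_consistency
    {P : Type*} [MeasurableSpace P] (μ : Measure P) [IsProbabilityMeasure μ]
    (k n : ℕ) (hk : 1 ≤ k) (hn : 1 ≤ n)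
    (δ ε : ℝ) (hδ : δ ∈ Set.Ioo (0 : ℝ) 1) (hε : ε ∈ Set.Ioo (0 : ℝ) 1)
    (rfull : P → ℝ) (hrfull_meas : Measurable rfull)
    (hrfull01 : ∀ x, rfull x ∈ Set.Icc (0 : ℝ) 1)
    (r : ℕ → P → ℝ)
    (hrmeas : ∀ j ∈ Finset.Icc 1 k, Measurable (r j))
    (hr01 : ∀ j ∈ Finset.Icc 1 k, ∀ x, r j x ∈ Set.Icc (0 : ℝ) 1) :
    (Measure.pi (fun _ : Fin n => μ))
      {ω | calmIndex k n δ ε (fun j x => max 0 (r j x - rfull x)) ω = 0 ∨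
        (∫ x, r (calmIndex k n δ ε (fun j x => max 0 (r j x - rfull x)) ω) x ∂μ)
          ≤ (∫ x, rfull x ∂μ) + δ} ≥ 1 - ENNReal.ofReal ε := by
  classical
  by_cases hbad : ∃ j, j ∈ Finset.Icc 1 k ∧ (∫ x, rfull x ∂μ) + δ < ∫ x, r j x ∂μ
  · obtain ⟨hmem, hlt⟩ := Nat.find_spec hbad
    set j := Nat.find hbad
    have hmeas : Measurable fun x => max 0 (r j x - rfull x) :=
      measurable_const.max ((hrmeas j hmem).sub hrfull_meas)
    have h01 : ∀ x, max 0 (r j x - rfull x) ∈ Set.Icc (0 : ℝ) 1 := fun x =>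
      ⟨le_max_left _ _, max_le zero_le_one (by linarith [(hr01 j hmem x).2, (hrfull01 x).1])⟩
    have hint_r : Integrable (r j) μ :=
      Integrable.of_mem_Icc 0 1 (hrmeas j hmem).aemeasurable (ae_of_all _ (hr01 j hmem))
    have hint_full : Integrable rfull μ :=
      Integrable.of_mem_Icc 0 1 hrfull_meas.aemeasurable (ae_of_all _ hrfull01)
    have hint_L : Integrable (fun x => max 0 (r j x - rfull x)) μ :=
      Integrable.of_mem_Icc 0 1 hmeas.aemeasurable (ae_of_all _ h01)
    have hexcess : δ < ∫ x, max 0 (r j x - rfull x) ∂μ := by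
      have hmono := integral_mono (hint_r.sub hint_full) hint_L fun x => le_max_right _ _
      simp only [Pi.sub_apply] at hmono
      rw [integral_sub hint_r hint_full] at hmono
      linarith
    have hset : MeasurableSet {ω : Fin n → P | Real.exp (-(2 * (n : ℝ)) *
        (max 0 (δ - (1 / (n : ℝ)) * ∑ s, max 0 (r j (ω s) - rfull (ω s)))) ^ 2) ≤ ε} := by
      have hcomp : ∀ s, Measurable fun ω : Fin n → P => max 0 (r j (ω s) - rfull (ω s)) :=
        fun s => hmeas.comp (measurable_pi_apply s)
      exact measurableSet_le (by fun_prop) measurable_const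
    refine le_trans (tsub_le_tsub_left
      (measure_pi_hoeffding_pvalue_le μ hn hε hmeas h01 hexcess) 1) ?_
    rw [← prob_compl_eq_one_sub hset]
    refine measure_mono fun ω hω => ?_
    obtain ⟨hle, hp⟩ := calmIndex_spec k n δ ε (fun j x => max 0 (r j x - rfull x)) ω
    by_contra hcon
    simp only [Set.mem_ofPred_eq, not_or, not_le] at hcon
    exact hω (hp j (Finset.mem_Icc.1 hmem).1 (Nat.find_min' hbad
      ⟨Finset.mem_Icc.2 ⟨Nat.one_le_iff_ne_zero.2 hcon.1, hle⟩, hcon.2⟩))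
  · push Not at hbad
    have hall : {ω : Fin n → P |
        calmIndex k n δ ε (fun j x => max 0 (r j x - rfull x)) ω = 0 ∨
        (∫ x, r (calmIndex k n δ ε (fun j x => max 0 (r j x - rfull x)) ω) x ∂μ)
          ≤ (∫ x, rfull x ∂μ) + δ} = Set.univ :=
      Set.eq_univ_of_forall fun ω => or_iff_not_imp_left.2 fun h0 =>
        hbad _ (Finset.mem_Icc.2 ⟨Nat.one_le_iff_ne_zero.2 h0, (calmIndex_spec ..).1⟩)
    rw [hall, measure_univ]
    exact tsub_le_self
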